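/- Let n > 3, s ≥ 1 and let Λ = (λ_1,…,λ_n), λ_j ∈ ℂ, be weakly hyperbolic. Let X = (0,z) ∈ Z_{(Λ,n,s)} be a point with w_1 = ⋯ = w_s = 0. Then the set Π(X) = {v ∈ T_X : α_X(v) = 0 and dα_X(v,u) = 0 for all u ∈ T_X} is exactly the set of vectors of the form −i(0, …, 0, 2 Re(T λ_1) z_1, …, 2 Re(T λ_n) z_n) with T ∈ ℂ, and Π(X) is a real vector subspace of dimension 2. -/

import Mathlib

open scoped BigOperators

/-- `Λ` is weakly hyperbolic (`k = 2`). -/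
def WeaklyHyperbolicC {n : ℕ} (Λ : Fin n → ℂ) : Prop :=
  ∀ J : Finset (Fin n), J.card ≤ 2 → (0 : ℂ) ∉ convexHull ℝ (Λ '' ↑J)

/-- The manifold `Z_{(Λ,n,s)} ⊆ ℂ^s × ℂ^n` cut out by
`F_s(w,z) = ∑ w_r² + ∑ λ_j |z_j|² = 0` and `ρ_s(w,z) = ∑ |w_r|² + ∑ |z_j|² = 1`. -/
def ZLS (s : ℕ) {n : ℕ} (Λ : Fin n → ℂ) : Set ((Fin s → ℂ) × (Fin n → ℂ)) :=
  {X | (∑ r, X.1 r ^ 2) + (∑ j, Λ j * (Complex.normSq (X.2 j) : ℂ)) = 0 ∧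
       (∑ r, Complex.normSq (X.1 r)) + (∑ j, Complex.normSq (X.2 j)) = 1}

/-- The tangent space of `Z_{(Λ,n,s)}` at `X = (w,z)`: all `v = (a,b) ∈ ℂ^s × ℂ^n` with
`∑ 2 w_r a_r + ∑ λ_j (conj(z_j) b_j + z_j conj(b_j)) = 0` and
`Re(∑ conj(w_r) a_r + ∑ conj(z_j) b_j) = 0`. -/
def TangentAt (s : ℕ) {n : ℕ} (Λ : Fin n → ℂ)
    (X v : (Fin s → ℂ) × (Fin n → ℂ)) : Prop :=
  ((∑ r, 2 * X.1 r * v.1 r) +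
      (∑ j, Λ j * ((starRingEnd ℂ) (X.2 j) * v.2 j + X.2 j * (starRingEnd ℂ) (v.2 j))) = 0) ∧
  ((∑ r, (starRingEnd ℂ) (X.1 r) * v.1 r) + (∑ j, (starRingEnd ℂ) (X.2 j) * v.2 j)).re = 0

/-- The `1`-form
`α_X(a,b) = i(∑ (w_r conj(a_r) − conj(w_r) a_r) + ∑ (z_j conj(b_j) − conj(z_j) b_j))`. -/
noncomputable def alphaForm {s n : ℕ} (X v : (Fin s → ℂ) × (Fin n → ℂ)) : ℂ :=
  Complex.I *
    ((∑ r, (X.1 r * (starRingEnd ℂ) (v.1 r) - (starRingEnd ℂ) (X.1 r) * v.1 r)) +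
     (∑ j, (X.2 j * (starRingEnd ℂ) (v.2 j) - (starRingEnd ℂ) (X.2 j) * v.2 j)))

/-- The constant `2`-form
`dα(u,v) = 2i(∑ (u_r conj(v_r) − v_r conj(u_r)) + ∑ (u_{s+j} conj(v_{s+j}) − v_{s+j} conj(u_{s+j})))`. -/
noncomputable def dAlpha {s n : ℕ} (u v : (Fin s → ℂ) × (Fin n → ℂ)) : ℂ :=
  2 * Complex.I *
    ((∑ r, (u.1 r * (starRingEnd ℂ) (v.1 r) - v.1 r * (starRingEnd ℂ) (u.1 r))) +
     (∑ j, (u.2 j * (starRingEnd ℂ) (v.2 j) - v.2 j * (starRingEnd ℂ) (u.2 j))))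

/-- The vector `v(T,μ) = −i(2 conj(T) conj(w_1) + μ w_1, …, 2 conj(T) conj(w_s) + μ w_s,
(2 Re(T λ_1) + μ) z_1, …, (2 Re(T λ_n) + μ) z_n)`. -/
noncomputable def vTmu {s n : ℕ} (Λ : Fin n → ℂ) (X : (Fin s → ℂ) × (Fin n → ℂ)) (T : ℂ) (μ : ℝ) :
    (Fin s → ℂ) × (Fin n → ℂ) :=
  (fun r => -Complex.I * (2 * (starRingEnd ℂ) T * (starRingEnd ℂ) (X.1 r) + (μ : ℂ) * X.1 r),
   fun j => -Complex.I * (((2 * (T * Λ j).re + μ : ℝ) : ℂ) * X.2 j))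

open ComplexConjugate

/-- A linear form vanishing on the common kernel of three others is a combination of them. -/
lemma exists_eq_combination_of_vanish {E : Type*} [AddCommGroup E] [Module ℝ E]
    (f₁ f₂ f₃ g : E →ₗ[ℝ] ℝ) (h : ∀ u, f₁ u = 0 → f₂ u = 0 → f₃ u = 0 → g u = 0) :
    ∃ a b c : ℝ, ∀ u, g u = a * f₁ u + b * f₂ u + c * f₃ u := by
  have hmem : g ∈ Submodule.span ℝ (Set.range ![f₁, f₂, f₃]) := by
    apply mem_span_of_iInf_ker_le_ker
    intro u hu
    simp only [Submodule.mem_iInf, LinearMap.mem_ker] at hu ⊢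
    exact h u (hu 0) (hu 1) (hu 2)
  obtain ⟨c, hc⟩ := (Submodule.mem_span_range_iff_exists_fun ℝ).1 hmem
  refine ⟨c 0, c 1, c 2, fun u => ?_⟩
  rw [← hc]
  simp [Fin.sum_univ_three]

/-- The real-linear form `u ↦ Re (∑ c_r u_r + ∑ d_j u_{s+j})` on `ℂ^s × ℂ^n`. -/
noncomputable def rePairing {s n : ℕ} (c : (Fin s → ℂ) × (Fin n → ℂ)) :
    ((Fin s → ℂ) × (Fin n → ℂ)) →ₗ[ℝ] ℝ where
  toFun u := ((∑ r, c.1 r * u.1 r) + ∑ j, c.2 j * u.2 j).re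
  map_add' u v := by
    simp only [Prod.fst_add, Prod.snd_add, Pi.add_apply, mul_add, Finset.sum_add_distrib,
      Complex.add_re]
    ring
  map_smul' t u := by
    simp only [Prod.smul_fst, Prod.smul_snd, Pi.smul_apply, mul_smul_comm, ← Finset.smul_sum,
      ← smul_add, Complex.smul_re, RingHom.id_apply]

lemma rePairing_apply {s n : ℕ} (c u : (Fin s → ℂ) × (Fin n → ℂ)) :
    rePairing c u = ((∑ r, c.1 r * u.1 r) + ∑ j, c.2 j * u.2 j).re := rfl

lemma rePairing_single_left {s n : ℕ} (c : (Fin s → ℂ) × (Fin n → ℂ)) (r : Fin s) (x : ℂ) :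
    rePairing c (Pi.single r x, 0) = (c.1 r * x).re := by
  simp [rePairing_apply, Pi.single_apply]

lemma rePairing_single_right {s n : ℕ} (c : (Fin s → ℂ) × (Fin n → ℂ)) (j : Fin n) (x : ℂ) :
    rePairing c (0, Pi.single j x) = (c.2 j * x).re := by
  simp [rePairing_apply, Pi.single_apply]

lemma eq_of_forall_re_mul {a b : ℂ} (h : ∀ x : ℂ, (a * x).re = (b * x).re) : a = b := by
  have h1 := h 1
  have h2 := h Complex.I
  apply Complex.ext <;> simp_all

lemma dAlpha_eq_rePairing {s n : ℕ} (v u : (Fin s → ℂ) × (Fin n → ℂ)) :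
    dAlpha v u = ((-4 * rePairing
      (fun r => Complex.I * conj (v.1 r), fun j => Complex.I * conj (v.2 j)) u : ℝ) : ℂ) := by
  have key (x y : ℂ) : x * conj y - y * conj x
      = 2 * Complex.I * (((Complex.I * conj x * y).re : ℝ) : ℂ) := by
    apply Complex.ext <;> simp <;> ring
  simp only [dAlpha, key, rePairing_apply, ← Finset.mul_sum, Complex.add_re, Complex.re_sum]
  push_cast
  linear_combination (4 * ((∑ r, (((Complex.I * conj (v.1 r) * u.1 r).re : ℝ) : ℂ))
    + ∑ j, (((Complex.I * conj (v.2 j) * u.2 j).re : ℝ) : ℂ))) * Complex.I_mul_I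

/-- Over a point with `w = 0` the tangent space is the common kernel of three real forms. -/
lemma tangentAt_iff_of_fst_eq_zero {s n : ℕ} (Λ : Fin n → ℂ) (X u : (Fin s → ℂ) × (Fin n → ℂ))
    (hw : X.1 = 0) :
    TangentAt s Λ X u ↔
      rePairing (0, fun j => ((Λ j).re : ℂ) * conj (X.2 j)) u = 0 ∧
      rePairing (0, fun j => ((Λ j).im : ℂ) * conj (X.2 j)) u = 0 ∧
      rePairing (0, fun j => conj (X.2 j)) u = 0 := by
  have key (a x y : ℂ) : a * (conj x * y + x * conj y)
      = 2 * ((((a.re : ℂ) * conj x * y).re : ℝ) + (((a.im : ℂ) * conj x * y).re : ℝ)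
        * Complex.I) := by
    apply Complex.ext <;> simp <;> ring
  simp only [TangentAt, hw, key, rePairing_apply, ← Finset.mul_sum, Finset.sum_add_distrib,
    ← Finset.sum_mul, Pi.zero_apply, mul_zero, zero_mul, Finset.sum_const_zero, zero_add,
    map_zero, Complex.re_sum, ← Complex.ofReal_sum, mul_eq_zero, OfNat.ofNat_ne_zero, false_or]
  rw [Complex.ext_iff]
  simp [and_assoc]

lemma WeaklyHyperbolicC.ne_zero {n : ℕ} {Λ : Fin n → ℂ} (hΛ : WeaklyHyperbolicC Λ) (j : Fin n) :
    Λ j ≠ 0 := by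
  intro h
  apply hΛ {j} (by simp)
  simp [h]

lemma WeaklyHyperbolicC.combination_ne_zero {n : ℕ} {Λ : Fin n → ℂ} (hΛ : WeaklyHyperbolicC Λ)
    (j k : Fin n) {a b : ℝ} (ha : 0 < a) (hb : 0 < b) : (a : ℂ) * Λ j + b * Λ k ≠ 0 := by
  intro h
  apply hΛ {j, k} Finset.card_le_two
  rw [Finset.coe_pair, Set.image_pair, convexHull_pair]
  refine ⟨a / (a + b), b / (a + b), by positivity, by positivity, by field_simp, ?_⟩
  have hab : ((a : ℂ) + b) ≠ 0 := by exact_mod_cast (add_pos ha hb).ne'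
  simp only [Complex.real_smul]
  push_cast
  field_simp
  rw [h, mul_zero]

/-- A positive relation between weakly hyperbolic numbers forces its support not to lie on a
real line. -/
lemma WeaklyHyperbolicC.eq_zero_of_re_mul_eq_zero {n : ℕ} {Λ : Fin n → ℂ}
    (hΛ : WeaklyHyperbolicC Λ) {p : Fin n → ℝ} (hp : ∀ j, 0 ≤ p j) (hp₁ : ∃ j, p j ≠ 0)
    (hsum : ∑ j, Λ j * (p j : ℂ) = 0) {T : ℂ} (hT : ∀ j, p j ≠ 0 → (T * Λ j).re = 0) : T = 0 := by
  by_contra hT0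
  have him : ∑ j, (T * Λ j).im * p j = 0 := by
    have := congrArg (fun x : ℂ => (T * x).im) hsum
    simpa only [Finset.mul_sum, ← mul_assoc, Complex.im_sum, Complex.im_mul_ofReal, mul_zero,
      Complex.zero_im] using this
  obtain ⟨i, hi⟩ := hp₁
  have hne : (T * Λ i).im * p i ≠ 0 := by
    refine mul_ne_zero (fun h => mul_ne_zero hT0 (hΛ.ne_zero i) ?_) hi
    exact Complex.ext (hT i hi) h
  obtain ⟨j, -, hj⟩ := Finset.exists_pos_of_sum_zero_of_exists_nonzero _ him
    ⟨i, Finset.mem_univ i, hne⟩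
  obtain ⟨k, -, hk⟩ := Finset.exists_pos_of_sum_zero_of_exists_nonzero
    (fun j => -((T * Λ j).im * p j)) (s := Finset.univ)
    (by rw [Finset.sum_neg_distrib, him, neg_zero])
    ⟨i, Finset.mem_univ i, neg_ne_zero.2 hne⟩
  have hyj : 0 < (T * Λ j).im := pos_of_mul_pos_left hj (hp j)
  have hyk : 0 < -(T * Λ k).im := by
    rw [← neg_mul] at hk
    exact pos_of_mul_pos_left hk (hp k)
  have hpj : p j ≠ 0 := right_ne_zero_of_mul hj.ne'
  have hpk : p k ≠ 0 := right_ne_zero_of_mul (neg_pos.1 hk).ne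
  refine mul_ne_zero hT0 (hΛ.combination_ne_zero j k hyk hyj) ?_
  have ej : T * Λ j = ((T * Λ j).im : ℂ) * Complex.I := by
    apply Complex.ext <;>
      simp [-Complex.mul_re, -Complex.mul_im, Complex.re_ofReal_mul, Complex.im_ofReal_mul, hT j hpj]
  have ek : T * Λ k = ((T * Λ k).im : ℂ) * Complex.I := by
    apply Complex.ext <;>
      simp [-Complex.mul_re, -Complex.mul_im, Complex.re_ofReal_mul, Complex.im_ofReal_mul, hT k hpk]
  push_cast
  linear_combination (-((T * Λ k).im : ℂ)) * ej + ((T * Λ j).im : ℂ) * ek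

/-- The real-linear map `T ↦ −i(0, …, 0, 2 Re(T λ_1) z_1, …, 2 Re(T λ_n) z_n)`. -/
noncomputable def bindingMap (s : ℕ) {n : ℕ} (Λ z : Fin n → ℂ) :
    ℂ →ₗ[ℝ] ((Fin s → ℂ) × (Fin n → ℂ)) where
  toFun T := (0, fun j => -Complex.I * (((2 * (T * Λ j).re : ℝ) : ℂ) * z j))
  map_add' S T := by
    ext j <;> simp only [Prod.mk_add_mk, add_zero, Pi.add_apply, add_mul, Complex.add_re]
    push_cast
    ring
  map_smul' t T := by
    ext j
    · simp
    · simp only [Complex.real_smul, mul_assoc, Complex.re_ofReal_mul, RingHom.id_apply,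
        Prod.smul_mk, Pi.smul_apply]
      push_cast
      ring

lemma bindingMap_apply (s : ℕ) {n : ℕ} (Λ z : Fin n → ℂ) (T : ℂ) :
    bindingMap s Λ z T = (0, fun j => -Complex.I * (((2 * (T * Λ j).re : ℝ) : ℂ) * z j)) := rfl

lemma rePairing_bindingMap {s n : ℕ} (Λ z : Fin n → ℂ) (p : Fin n → ℝ) (T : ℂ) :
    rePairing (0, fun j => (p j : ℂ) * conj (z j)) (bindingMap s Λ z T) = 0 := by
  simp only [rePairing_apply, bindingMap_apply, Pi.zero_apply, mul_zero, Finset.sum_const_zero,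
    zero_add, Complex.re_sum]
  refine Finset.sum_eq_zero fun j _ => ?_
  rw [show (p j : ℂ) * conj (z j) * (-Complex.I * (((2 * (T * Λ j).re : ℝ) : ℂ) * z j))
    = ((-(p j * (2 * (T * Λ j).re) * Complex.normSq (z j)) : ℝ) : ℂ) * Complex.I by
      push_cast [← Complex.mul_conj]; ring]
  rw [Complex.re_ofReal_mul, Complex.I_re, mul_zero]

/-- Over a point with `w = 0`, a vector that is `dα`-orthogonal to the tangent space has the form
`−i(0, …, 0, (2 Re(T λ_1) + μ) z_1, …, (2 Re(T λ_n) + μ) z_n)`. -/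
lemma exists_eq_of_forall_dAlpha_eq_zero {s n : ℕ} (Λ : Fin n → ℂ)
    (X v : (Fin s → ℂ) × (Fin n → ℂ)) (hw : X.1 = 0)
    (h : ∀ u, TangentAt s Λ X u → dAlpha v u = 0) :
    ∃ (T : ℂ) (μ : ℝ), v = (0, fun j => -Complex.I * (((2 * (T * Λ j).re + μ : ℝ) : ℂ) * X.2 j)) := by
  obtain ⟨a, b, c, habc⟩ := exists_eq_combination_of_vanish _ _ _
    (rePairing (fun r => Complex.I * conj (v.1 r), fun j => Complex.I * conj (v.2 j)))
    (fun u h₁ h₂ h₃ => by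
      have := h u ((tangentAt_iff_of_fst_eq_zero Λ X u hw).2 ⟨h₁, h₂, h₃⟩)
      rw [dAlpha_eq_rePairing] at this
      simpa using this)
  refine ⟨⟨-a / 2, b / 2⟩, -c, Prod.ext (funext fun r => ?_) (funext fun j => ?_)⟩
  · have := eq_of_forall_re_mul (a := Complex.I * conj (v.1 r)) (b := 0) fun x => by
      have := habc (Pi.single r x, 0)
      simp only [rePairing_single_left, Pi.zero_apply, zero_mul, Complex.zero_re, mul_zero,
        add_zero] at this
      simpa only [zero_mul, Complex.zero_re] using this
    simpa using this
  · have := eq_of_forall_re_mul (a := Complex.I * conj (v.2 j))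
      (b := ((a * (Λ j).re + b * (Λ j).im + c : ℝ) : ℂ) * conj (X.2 j)) fun x => by
        have := habc (0, Pi.single j x)
        simp only [rePairing_single_right] at this
        rw [this, mul_assoc, mul_assoc, mul_assoc, Complex.re_ofReal_mul, Complex.re_ofReal_mul,
          Complex.re_ofReal_mul]
        ring
    have hv := congrArg (fun x => Complex.I * conj x) this
    simp only [map_mul, Complex.conj_I, Complex.conj_conj, Complex.conj_ofReal] at hv
    simp only [Complex.mul_re]
    push_cast at hv ⊢
    linear_combination hv + v.2 j * Complex.I_mul_I

lemma dAlpha_imaginary_multiple {s n : ℕ} (X u : (Fin s → ℂ) × (Fin n → ℂ)) (q : Fin n → ℝ) :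
    dAlpha ((0, fun j => -Complex.I * ((q j : ℂ) * X.2 j)) : (Fin s → ℂ) × (Fin n → ℂ)) u =
      ((4 * rePairing (0, fun j => (q j : ℂ) * conj (X.2 j)) u : ℝ) : ℂ) := by
  rw [dAlpha_eq_rePairing]
  congr 1
  simp only [rePairing_apply, Pi.zero_apply, map_zero, mul_zero, zero_mul, Finset.sum_const_zero,
    zero_add, map_mul, map_neg, Complex.conj_I, Complex.conj_ofReal]
  have (j : Fin n) : Complex.I * (- -Complex.I * ((q j : ℂ) * conj (X.2 j))) * u.2 j
      = -((q j : ℂ) * conj (X.2 j) * u.2 j) := by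
    linear_combination ((q j : ℂ) * conj (X.2 j) * u.2 j) * Complex.I_mul_I
  simp only [this, Finset.sum_neg_distrib, Complex.neg_re]
  ring

/-- At a point `X = (0,z) ∈ Z_{(Λ,n,s)}` with `w_1 = ⋯ = w_s = 0`, the set
`Π(X) = {v ∈ T_X : α_X(v) = 0 ∧ dα_X(v,u) = 0 for all u ∈ T_X}` consists exactly of the
vectors `−i(0,…,0, 2 Re(T λ_1) z_1, …, 2 Re(T λ_n) z_n)` with `T ∈ ℂ`, and is a real vector
subspace of dimension `2` (expressed as the range of an injective real-linear map on `ℂ`). -/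
theorem Pi_of_binding_point {n s : ℕ} (hn : 3 < n) (hs : 1 ≤ s)
    (Λ : Fin n → ℂ) (hΛ : WeaklyHyperbolicC Λ)
    (X : (Fin s → ℂ) × (Fin n → ℂ)) (hX : X ∈ ZLS s Λ) (hw : X.1 = 0) :
    {v : (Fin s → ℂ) × (Fin n → ℂ) | TangentAt s Λ X v ∧ alphaForm X v = 0 ∧
        ∀ u : (Fin s → ℂ) × (Fin n → ℂ), TangentAt s Λ X u → dAlpha v u = 0}
      = {v : (Fin s → ℂ) × (Fin n → ℂ) | ∃ T : ℂ,
          v = (0, fun j => -Complex.I * (((2 * (T * Λ j).re : ℝ) : ℂ) * X.2 j))} ∧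
    ∃ f : ℂ →ₗ[ℝ] ((Fin s → ℂ) × (Fin n → ℂ)), Function.Injective f ∧
      Set.range f
        = {v : (Fin s → ℂ) × (Fin n → ℂ) | TangentAt s Λ X v ∧ alphaForm X v = 0 ∧
            ∀ u : (Fin s → ℂ) × (Fin n → ℂ), TangentAt s Λ X u → dAlpha v u = 0} := by
  obtain ⟨hF, hρ⟩ := hX
  simp only [hw, Pi.zero_apply, ne_eq, OfNat.ofNat_ne_zero, not_false_eq_true, zero_pow,
    Finset.sum_const_zero, zero_add, map_zero] at hF hρ
  have hsum (T : ℂ) : ∑ j, (T * Λ j).re * Complex.normSq (X.2 j) = 0 := by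
    have := congrArg (fun x : ℂ => (T * x).re) hF
    simpa only [Finset.mul_sum, ← mul_assoc, Complex.re_sum, Complex.re_mul_ofReal, mul_zero,
      Complex.zero_re] using this
  have hα (T : ℂ) (μ : ℝ) :
      alphaForm X (0, fun j => -Complex.I * (((2 * (T * Λ j).re + μ : ℝ) : ℂ) * X.2 j))
        = ((-2 * μ : ℝ) : ℂ) := by
    have key (t : ℝ) (x : ℂ) : x * conj (-Complex.I * ((t : ℂ) * x))
        - conj x * (-Complex.I * ((t : ℂ) * x))
        = 2 * Complex.I * ((t * Complex.normSq x : ℝ) : ℂ) := by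
      push_cast [← Complex.mul_conj]
      simp only [map_mul, map_neg, Complex.conj_I, Complex.conj_ofReal]
      ring
    have hμ : ∑ j, (2 * (T * Λ j).re + μ) * Complex.normSq (X.2 j) = μ := by
      simp only [add_mul, Finset.sum_add_distrib, mul_assoc (2 : ℝ), ← Finset.mul_sum, hsum, hρ]
      ring
    simp only [alphaForm, hw, key, ← Finset.mul_sum, ← Complex.ofReal_sum, hμ, Pi.zero_apply,
      map_zero, mul_zero, sub_zero, Finset.sum_const_zero, zero_add]
    push_cast
    linear_combination 2 * (μ : ℂ) * Complex.I_mul_I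
  have hset : {v : (Fin s → ℂ) × (Fin n → ℂ) | TangentAt s Λ X v ∧ alphaForm X v = 0 ∧
        ∀ u : (Fin s → ℂ) × (Fin n → ℂ), TangentAt s Λ X u → dAlpha v u = 0}
      = {v : (Fin s → ℂ) × (Fin n → ℂ) | ∃ T : ℂ,
          v = (0, fun j => -Complex.I * (((2 * (T * Λ j).re : ℝ) : ℂ) * X.2 j))} := by
    ext v
    constructor
    · rintro ⟨-, hv, hd⟩
      obtain ⟨T, μ, rfl⟩ := exists_eq_of_forall_dAlpha_eq_zero Λ X v hw hd
      rw [hα] at hv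
      have hμ : μ = 0 := by simpa using hv
      exact ⟨T, by simp only [hμ, add_zero]⟩
    · rintro ⟨T, rfl⟩
      refine ⟨?_, by simpa only [add_zero, mul_zero, Complex.ofReal_zero] using hα T 0,
        fun u hu => ?_⟩
      · rw [tangentAt_iff_of_fst_eq_zero Λ X _ hw, ← bindingMap_apply]
        refine ⟨rePairing_bindingMap _ _ _ _, rePairing_bindingMap _ _ _ _, ?_⟩
        simpa only [Complex.ofReal_one, one_mul] using
          rePairing_bindingMap (s := s) Λ X.2 (fun _ => 1) T
      · obtain ⟨h₁, h₂, -⟩ := (tangentAt_iff_of_fst_eq_zero Λ X u hw).1 hu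
        rw [dAlpha_imaginary_multiple X u]
        have : rePairing (0, fun j => ((2 * (T * Λ j).re : ℝ) : ℂ) * conj (X.2 j)) u
            = 2 * T.re * rePairing (0, fun j => ((Λ j).re : ℂ) * conj (X.2 j)) u
              - 2 * T.im * rePairing (0, fun j => ((Λ j).im : ℂ) * conj (X.2 j)) u := by
          simp only [rePairing_apply, Pi.zero_apply, zero_mul, Finset.sum_const_zero, zero_add,
            Complex.re_sum, Finset.mul_sum, ← Finset.sum_sub_distrib, mul_assoc (Complex.ofReal _),
            Complex.re_ofReal_mul, Complex.mul_re T]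
          refine Finset.sum_congr rfl fun j _ => ?_
          ring
        rw [this, h₁, h₂]
        simp
  refine ⟨hset, bindingMap s Λ X.2, ?_, ?_⟩
  · rw [← LinearMap.ker_eq_bot, LinearMap.ker_eq_bot']
    intro T hT
    refine hΛ.eq_zero_of_re_mul_eq_zero (fun j => Complex.normSq_nonneg (X.2 j)) ?_ hF fun j hj => ?_
    · by_contra! h
      simp [h] at hρ
    · have hj' : X.2 j ≠ 0 := fun h => hj (by simp [h])
      have := congrFun (congrArg Prod.snd hT) j
      simp only [bindingMap_apply, Prod.snd_zero, Pi.zero_apply, mul_eq_zero, neg_eq_zero,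
        Complex.I_ne_zero, hj', or_false, false_or, Complex.ofReal_eq_zero,
        OfNat.ofNat_ne_zero] at this
      exact this
  · rw [hset]
    ext v
    simp only [Set.mem_range, bindingMap_apply, Set.mem_ofPred_eq, eq_comm]
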